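/- Let 0 → A → B → C → E → 0 be an exact sequence of finite free modules (or locally free sheaves) over a commutative ℚ-algebra. Then the sequence 0 → S²A → A⊗B → Λ²B ⊕ (A⊗C) → B⊗C → S²C → S²E → 0 is exact, with maps induced by the given maps, symmetrization, and antisymmetrization as in the mapping cone of the standard resolutions of Λ²(B/A) and (B/A)⊗C. -/

import Mathlib

open TensorProduct

noncomputable section

/-- The submodule of `M ⊗ M` generated by the antisymmetric tensors `x ⊗ y - y ⊗ x`. -/
def symRel (R M : Type*) [CommRing R] [AddCommGroup M] [Module R M] :
    Submodule R (M ⊗[R] M) :=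
  Submodule.span R {z | ∃ x y : M, z = x ⊗ₜ[R] y - y ⊗ₜ[R] x}

/-- The second symmetric power `S²M`, as the quotient of `M ⊗ M` by antisymmetric tensors. -/
abbrev Sym2Mod (R M : Type*) [CommRing R] [AddCommGroup M] [Module R M] :=
  (M ⊗[R] M) ⧸ symRel R M

/-- The wedge `a ∧ b` as an element of the second exterior power `⋀²M`. -/
def wedge2 (R : Type*) [CommRing R] {M : Type*} [AddCommGroup M] [Module R M]
    (a b : M) : ⋀[R]^2 M :=
  ⟨ExteriorAlgebra.ιMulti R 2 ![a, b],
    ExteriorAlgebra.ιMulti_range R 2 (Set.mem_range_self _)⟩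

theorem symRel_mkQ_comm (R : Type*) {M : Type*} [CommRing R] [AddCommGroup M] [Module R M]
    (x y : M) : (symRel R M).mkQ (x ⊗ₜ[R] y) = (symRel R M).mkQ (y ⊗ₜ[R] x) := by
  rw [← sub_eq_zero, ← map_sub, Submodule.mkQ_apply, Submodule.Quotient.mk_eq_zero]
  exact Submodule.subset_span ⟨x, y, rfl⟩

/-- The linear map out of `S²M` induced by a symmetric bilinear map. -/
def symLift {R M N : Type*} [CommRing R] [AddCommGroup M] [Module R M]
    [AddCommGroup N] [Module R N] (φ : M →ₗ[R] M →ₗ[R] N) (hφ : ∀ x y, φ x y = φ y x) :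
    Sym2Mod R M →ₗ[R] N :=
  (symRel R M).liftQ (TensorProduct.lift φ) (Submodule.span_le.2 (by
    rintro _ ⟨x, y, rfl⟩
    simp [hφ x y]))

theorem symLift_mkQ {R M N : Type*} [CommRing R] [AddCommGroup M] [Module R M]
    [AddCommGroup N] [Module R N] (φ : M →ₗ[R] M →ₗ[R] N) (hφ : ∀ x y, φ x y = φ y x)
    (x y : M) : symLift φ hφ ((symRel R M).mkQ (x ⊗ₜ[R] y)) = φ x y := rfl

theorem sym2Mod_hom_ext {R M N : Type*} [CommRing R] [AddCommGroup M] [Module R M]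
    [AddCommGroup N] [Module R N] {φ ψ : Sym2Mod R M →ₗ[R] N}
    (H : ∀ x y : M, φ ((symRel R M).mkQ (x ⊗ₜ[R] y)) = ψ ((symRel R M).mkQ (x ⊗ₜ[R] y))) :
    φ = ψ :=
  Submodule.linearMap_qext _ (TensorProduct.ext' H)

theorem wedge2_eq_ιMulti (R : Type*) [CommRing R] {M : Type*} [AddCommGroup M] [Module R M]
    (a b : M) : wedge2 R a b = exteriorPower.ιMulti R 2 ![a, b] := rfl

theorem wedge2_self (R : Type*) [CommRing R] {M : Type*} [AddCommGroup M] [Module R M]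
    (a : M) : wedge2 R a a = 0 :=
  (exteriorPower.ιMulti R 2).map_eq_zero_of_eq ![a, a] (i := 0) (j := 1) rfl (by decide)

theorem update_vecTwo_zero {M : Type*} (x y z : M) :
    Function.update ![x, y] 0 z = ![z, y] := by
  ext i
  fin_cases i <;> simp

theorem update_vecTwo_one {M : Type*} (x y z : M) :
    Function.update ![x, y] 1 z = ![x, z] := by
  ext i
  fin_cases i <;> simp

/-- The wedge product `M × M → ⋀²M` as a bilinear map. -/
def wedgeBilin (R M : Type*) [CommRing R] [AddCommGroup M] [Module R M] :
    M →ₗ[R] M →ₗ[R] ⋀[R]^2 M :=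
  LinearMap.mk₂ R (wedge2 R)
    (fun x y b => by
      have H := (exteriorPower.ιMulti R 2).map_update_add ![x, b] 0 x y
      simp only [update_vecTwo_zero] at H
      exact H)
    (fun c x b => by
      have H := (exteriorPower.ιMulti R 2).map_update_smul ![x, b] 0 c x
      simp only [update_vecTwo_zero] at H
      exact H)
    (fun b x y => by
      have H := (exteriorPower.ιMulti R 2).map_update_add ![b, x] 1 x y
      simp only [update_vecTwo_one] at H
      exact H)
    (fun c b x => by
      have H := (exteriorPower.ιMulti R 2).map_update_smul ![b, x] 1 c x
      simp only [update_vecTwo_one] at H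
      exact H)

theorem wedgeBilin_apply {R M : Type*} [CommRing R] [AddCommGroup M] [Module R M] (a b : M) :
    wedgeBilin R M a b = wedge2 R a b := rfl

theorem wedge2_swap (R : Type*) [CommRing R] {M : Type*} [AddCommGroup M] [Module R M]
    (a b : M) : wedge2 R a b = -wedge2 R b a := by
  have H := wedge2_self R (a + b)
  simp only [← wedgeBilin_apply, map_add, LinearMap.add_apply] at H
  simp only [wedgeBilin_apply, wedge2_self, zero_add, add_zero] at H
  exact eq_neg_of_add_eq_zero_right H

/-- The linear map out of `⋀²M` sending `x ∧ y` to `φ x y - φ y x`. -/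
def wedgeLift {R M N : Type*} [CommRing R] [AddCommGroup M] [Module R M]
    [AddCommGroup N] [Module R N] (φ : M →ₗ[R] M →ₗ[R] N) : ⋀[R]^2 M →ₗ[R] N :=
  exteriorPower.alternatingMapLinearEquiv
    { toFun := fun v => φ (v 0) (v 1) - φ (v 1) (v 0)
      map_update_add' := by
        intro inst v i x y
        rw [Subsingleton.elim inst (instDecidableEqFin 2)]
        fin_cases i <;> simp <;> abel
      map_update_smul' := by
        intro inst v i c x
        rw [Subsingleton.elim inst (instDecidableEqFin 2)]
        fin_cases i <;> simp [smul_sub]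
      map_eq_zero_of_eq' := by
        intro v i j hv hij
        have : v 0 = v 1 := by
          fin_cases i <;> fin_cases j <;> simp_all
        simp [this] }

theorem wedgeLift_wedge2 {R M N : Type*} [CommRing R] [AddCommGroup M] [Module R M]
    [AddCommGroup N] [Module R N] (φ : M →ₗ[R] M →ₗ[R] N) (x y : M) :
    wedgeLift φ (wedge2 R x y) = φ x y - φ y x := by
  rw [wedge2_eq_ιMulti, wedgeLift, exteriorPower.alternatingMapLinearEquiv_apply_ιMulti]
  rfl

theorem exteriorPower_two_hom_ext {R M N : Type*} [CommRing R] [AddCommGroup M] [Module R M]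
    [AddCommGroup N] [Module R N] {φ ψ : ⋀[R]^2 M →ₗ[R] N}
    (H : ∀ x y : M, φ (wedge2 R x y) = ψ (wedge2 R x y)) : φ = ψ := by
  refine exteriorPower.linearMap_ext (AlternatingMap.ext fun v => ?_)
  have hv : v = ![v 0, v 1] := by
    ext i
    fin_cases i <;> rfl
  rw [hv]
  exact H (v 0) (v 1)

/-- A complex is exact at a spot where its identity is null-homotopic. -/
theorem exact_of_nullHomotopic {R X Y Z : Type*} [CommRing R] [AddCommGroup X] [Module R X]
    [AddCommGroup Y] [Module R Y] [AddCommGroup Z] [Module R Z]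
    {α : X →ₗ[R] Y} {β : Y →ₗ[R] Z} (p : Y →ₗ[R] X) (q : Z →ₗ[R] Y)
    (hαβ : β ∘ₗ α = 0) (H : α ∘ₗ p + q ∘ₗ β = LinearMap.id) : Function.Exact α β := by
  refine fun y => ⟨fun hy => ⟨p y, ?_⟩, ?_⟩
  · simpa [hy] using LinearMap.congr_fun H y
  · rintro ⟨x, rfl⟩
    exact LinearMap.congr_fun hαβ x

/-- An exact sequence `0 → A → B → C → E → 0` with `C` and `E` projective is contractible. -/
theorem exists_contraction {R A B C E : Type*} [CommRing R]
    [AddCommGroup A] [Module R A] [AddCommGroup B] [Module R B]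
    [AddCommGroup C] [Module R C] [Module.Projective R C]
    [AddCommGroup E] [Module R E] [Module.Projective R E]
    (f : A →ₗ[R] B) (g : B →ₗ[R] C) (h : C →ₗ[R] E)
    (hf : Function.Injective f) (hfg : Function.Exact f g)
    (hgh : Function.Exact g h) (hh : Function.Surjective h) :
    ∃ (r : B →ₗ[R] A) (s : C →ₗ[R] B) (u : E →ₗ[R] C),
      (∀ a, r (f a) = a) ∧ (∀ b, f (r b) + s (g b) = b) ∧ (∀ c, g (s c) + u (h c) = c) ∧
      (∀ e, h (u e) = e) ∧ (∀ e, s (u e) = 0) := by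
  obtain ⟨u, hu⟩ := Module.projective_lifting_property h LinearMap.id hh
  replace hu : ∀ e, h (u e) = e := fun e => LinearMap.congr_fun hu e
  have hgh0 : ∀ b, h (g b) = 0 := fun b => (hgh _).2 ⟨b, rfl⟩
  have hfg0 : ∀ a, g (f a) = 0 := fun a => (hfg _).2 ⟨a, rfl⟩
  let π : C →ₗ[R] LinearMap.ker h :=
    (LinearMap.id - u ∘ₗ h).codRestrict _ (fun c => by simp [hu])
  let g' : B →ₗ[R] LinearMap.ker h := g.codRestrict _ (fun b => by simp [hgh0])
  have hg' : Function.Surjective g' := by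
    rintro ⟨c, hc⟩
    obtain ⟨b, rfl⟩ := (hgh c).1 hc
    exact ⟨b, rfl⟩
  obtain ⟨s₀, hs₀⟩ := Module.projective_lifting_property g' π hg'
  let s : C →ₗ[R] B := s₀ ∘ₗ (LinearMap.id - u ∘ₗ h)
  have hgs : ∀ c, g (s c) = c - u (h c) := fun c => by
    have := congrArg Subtype.val (LinearMap.congr_fun hs₀ (c - u (h c)))
    simpa [g', π, s, hu] using this
  have hs : ∀ b, b - s (g b) ∈ LinearMap.range f := fun b => by
    refine (hfg _).1 ?_
    simp [hgs, hgh0]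
  let e := LinearEquiv.ofInjective f hf
  let r : B →ₗ[R] A := e.symm.toLinearMap ∘ₗ (LinearMap.id - s ∘ₗ g).codRestrict _ hs
  have hfr : ∀ b, f (r b) = b - s (g b) := fun b =>
    congrArg Subtype.val (e.apply_symm_apply ⟨b - s (g b), hs b⟩)
  refine ⟨r, s, u, fun a => hf ?_, fun b => ?_, fun c => ?_, hu, fun e => ?_⟩
  · simp [hfr, hfg0]
  · simp [hfr]
  · simp [hgs]
  · simp [s, hu]

/-- Let `0 → A → B → C → E → 0` be an exact sequence of finite free
modules over a commutative `ℚ`-algebra.  Then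
`0 → S²A → A⊗B → Λ²B ⊕ (A⊗C) → B⊗C → S²C → S²E → 0`
is exact, with the maps induced by the given maps, symmetrization and
antisymmetrization as in the mapping cone of the standard resolutions of
`Λ²(B/A)` and `(B/A)⊗C`. -/
theorem statement10 (R : Type*) [CommRing R] [Algebra ℚ R]
    (A B C E : Type*)
    [AddCommGroup A] [Module R A] [Module.Free R A] [Module.Finite R A]
    [AddCommGroup B] [Module R B] [Module.Free R B] [Module.Finite R B]
    [AddCommGroup C] [Module R C] [Module.Free R C] [Module.Finite R C]
    [AddCommGroup E] [Module R E] [Module.Free R E] [Module.Finite R E]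
    (f : A →ₗ[R] B) (g : B →ₗ[R] C) (h : C →ₗ[R] E)
    (hf : Function.Injective f) (hfg : Function.Exact f g)
    (hgh : Function.Exact g h) (hh : Function.Surjective h)
    (σ1 : Sym2Mod R A →ₗ[R] (A ⊗[R] B))
    (hσ1 : ∀ a a' : A, σ1 ((symRel R A).mkQ (a ⊗ₜ[R] a')) =
      a ⊗ₜ[R] f a' + a' ⊗ₜ[R] f a)
    (σ2 : (A ⊗[R] B) →ₗ[R] ((⋀[R]^2 B) × (A ⊗[R] C)))
    (hσ2 : ∀ (a : A) (b : B), σ2 (a ⊗ₜ[R] b) = (wedge2 R (f a) b, a ⊗ₜ[R] g b))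
    (σ3 : ((⋀[R]^2 B) × (A ⊗[R] C)) →ₗ[R] (B ⊗[R] C))
    (hσ3 : (∀ b b' : B, σ3 (wedge2 R b b', 0) = b ⊗ₜ[R] g b' - b' ⊗ₜ[R] g b) ∧
      (∀ (a : A) (c : C), σ3 (0, a ⊗ₜ[R] c) = -(f a ⊗ₜ[R] c)))
    (σ4 : (B ⊗[R] C) →ₗ[R] Sym2Mod R C)
    (hσ4 : ∀ (b : B) (c : C), σ4 (b ⊗ₜ[R] c) = (symRel R C).mkQ (g b ⊗ₜ[R] c))
    (σ5 : Sym2Mod R C →ₗ[R] Sym2Mod R E)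
    (hσ5 : ∀ c c' : C, σ5 ((symRel R C).mkQ (c ⊗ₜ[R] c')) =
      (symRel R E).mkQ (h c ⊗ₜ[R] h c')) :
    Function.Injective σ1 ∧ Function.Exact σ1 σ2 ∧ Function.Exact σ2 σ3 ∧
      Function.Exact σ3 σ4 ∧ Function.Exact σ4 σ5 ∧ Function.Surjective σ5 := by
  obtain ⟨r, s, u, hrf, hB, hC, hhu, hsu⟩ := exists_contraction f g h hf hfg hgh hh
  have hgf : ∀ a, g (f a) = 0 := fun a => (hfg _).2 ⟨a, rfl⟩
  have hhg : ∀ b, h (g b) = 0 := fun b => (hgh _).2 ⟨b, rfl⟩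
  obtain ⟨κ, hκ⟩ : ∃ κ : R, κ + κ = 1 :=
    ⟨algebraMap ℚ R (1 / 2), by rw [← map_add]; norm_num⟩
  obtain ⟨hσ3, hσ3'⟩ := hσ3
  let p1 : A ⊗[R] B →ₗ[R] Sym2Mod R A :=
    κ • (symRel R A).mkQ ∘ₗ TensorProduct.map LinearMap.id r
  have hp1 : ∀ a b, p1 (a ⊗ₜ[R] b) = κ • (symRel R A).mkQ (a ⊗ₜ[R] r b) := fun a b => by
    simp [p1]
  let p2 : (⋀[R]^2 B) × (A ⊗[R] C) →ₗ[R] A ⊗[R] B :=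
    LinearMap.coprod (κ • wedgeLift ((TensorProduct.mk R A B).compl₁₂ r (f ∘ₗ r)))
      (TensorProduct.map LinearMap.id s)
  have hp2 : ∀ b b', p2 (wedge2 R b b', 0) =
      κ • (r b ⊗ₜ[R] f (r b') - r b' ⊗ₜ[R] f (r b)) := fun b b' => by
    simp [p2, wedgeLift_wedge2]
  have hp2' : ∀ a c, p2 (0, a ⊗ₜ[R] c) = a ⊗ₜ[R] s c := fun a c => by
    simp [p2]
  let p3 : B ⊗[R] C →ₗ[R] (⋀[R]^2 B) × (A ⊗[R] C) :=
    LinearMap.prod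
      (TensorProduct.lift ((wedgeBilin R B).compl₁₂ (f ∘ₗ r + κ • s ∘ₗ g) s))
      (-TensorProduct.map r (u ∘ₗ h))
  have hp3 : ∀ b c, p3 (b ⊗ₜ[R] c) =
      (wedge2 R (f (r b)) (s c) + κ • wedge2 R (s (g b)) (s c), -(r b ⊗ₜ[R] u (h c))) :=
    fun b c => by simp [p3, ← wedgeBilin_apply]
  let ψ : C →ₗ[R] C →ₗ[R] B ⊗[R] C :=
    (TensorProduct.mk R B C).compl₁₂ s (LinearMap.id + u ∘ₗ h)
  let p4 : Sym2Mod R C →ₗ[R] B ⊗[R] C :=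
    symLift (κ • (ψ + ψ.flip)) (fun x y => by simp [add_comm])
  have hp4 : ∀ c c', p4 ((symRel R C).mkQ (c ⊗ₜ[R] c')) =
      κ • (s c ⊗ₜ[R] (c' + u (h c')) + s c' ⊗ₜ[R] (c + u (h c))) := fun c c' => by
    simp only [p4, symLift_mkQ]
    simp [ψ]
  let p5 : Sym2Mod R E →ₗ[R] Sym2Mod R C :=
    symLift (((TensorProduct.mk R C C).compr₂ (symRel R C).mkQ).compl₁₂ u u)
      (fun x y => symRel_mkQ_comm R (u x) (u y))
  have hp5 : ∀ e e', p5 ((symRel R E).mkQ (e ⊗ₜ[R] e')) =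
      (symRel R C).mkQ (u e ⊗ₜ[R] u e') := fun e e' => by
    simp only [p5]
    rfl
  have hσ3pair : ∀ (b b' : B) (a : A) (c : C), σ3 (wedge2 R b b', a ⊗ₜ[R] c) =
      b ⊗ₜ[R] g b' - b' ⊗ₜ[R] g b - f a ⊗ₜ[R] c := fun b b' a c => by
    rw [sub_eq_add_neg _ (f a ⊗ₜ[R] c), ← hσ3, ← hσ3', ← map_add, Prod.mk_add_mk, add_zero,
      zero_add]
  have hp2pair : ∀ (b b' : B) (a : A) (c : C), p2 (wedge2 R b b', a ⊗ₜ[R] c) =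
      κ • (r b ⊗ₜ[R] f (r b') - r b' ⊗ₜ[R] f (r b)) + a ⊗ₜ[R] s c := fun b b' a c => by
    rw [← hp2, ← hp2', ← map_add, Prod.mk_add_mk, add_zero, zero_add]
  refine ⟨?_, exact_of_nullHomotopic p1 p2 ?_ ?_, exact_of_nullHomotopic p2 p3 ?_ ?_,
    exact_of_nullHomotopic p3 p4 ?_ ?_, exact_of_nullHomotopic p4 p5 ?_ ?_, ?_⟩
  · refine Function.LeftInverse.injective (g := p1) (LinearMap.congr_fun (?_ : p1 ∘ₗ σ1 = .id))
    refine sym2Mod_hom_ext fun a a' => ?_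
    simp only [LinearMap.comp_apply, LinearMap.id_apply, hσ1, map_add, hp1, hrf]
    rw [symRel_mkQ_comm R a' a, ← add_smul, hκ, one_smul]
  · refine sym2Mod_hom_ext fun a a' => ?_
    simp only [LinearMap.comp_apply, LinearMap.zero_apply, hσ1, map_add, hσ2, hgf,
      tmul_zero, wedge2_swap R (f a') (f a), Prod.mk_add_mk]
    simp
  · refine TensorProduct.ext' fun a b => ?_
    simp only [LinearMap.comp_apply, LinearMap.add_apply, LinearMap.id_apply, hσ2, hp1, map_smul,
      hσ1, hp2pair, hrf]
    conv_rhs => rw [← hB b, tmul_add]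
    linear_combination (norm := module) hκ • (a ⊗ₜ[R] f (r b))
  · refine TensorProduct.ext' fun a b => ?_
    simp only [LinearMap.comp_apply, LinearMap.zero_apply, hσ2, hσ3pair, hgf, tmul_zero]
    simp
  · refine LinearMap.prod_ext (exteriorPower_two_hom_ext fun b b' => ?_)
      (TensorProduct.ext' fun a c => ?_)
    · simp only [LinearMap.comp_apply, LinearMap.add_apply, LinearMap.id_apply,
        LinearMap.inl_apply, hσ3, hp2, map_smul, map_sub, hσ2, hp3, hgf, hhg, map_zero, tmul_zero]
      have hW : wedge2 R b b' = wedge2 R (f (r b)) (f (r b')) + wedge2 R (f (r b)) (s (g b')) +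
          wedge2 R (s (g b)) (f (r b')) + wedge2 R (s (g b)) (s (g b')) := by
        conv_lhs => rw [← hB b, ← hB b']
        simp only [← wedgeBilin_apply, map_add, LinearMap.add_apply]
        abel
      rw [hW, wedge2_swap R (f (r b')) (f (r b)), wedge2_swap R (s (g b')) (s (g b)),
        wedge2_swap R (f (r b')) (s (g b))]
      refine Prod.ext ?_ (by simp)
      simp only [Prod.fst_add, Prod.fst_sub, Prod.smul_fst]
      linear_combination (norm := module) hκ • (wedge2 R (f (r b)) (f (r b')) +
        wedge2 R (s (g b)) (s (g b')))
    · simp only [LinearMap.comp_apply, LinearMap.add_apply, LinearMap.id_apply,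
        LinearMap.inr_apply, hσ3', hp2', hσ2, map_neg, hp3, hgf, hrf, map_zero]
      refine Prod.ext ?_ ?_
      · simp [← wedgeBilin_apply]
      · conv_rhs => rw [← hC c]
        simp [tmul_add]
  · refine LinearMap.prod_ext (exteriorPower_two_hom_ext fun b b' => ?_)
      (TensorProduct.ext' fun a c => ?_)
    · simp only [LinearMap.comp_apply, LinearMap.zero_apply, LinearMap.inl_apply, hσ3, map_sub,
        hσ4, symRel_mkQ_comm R (g b') (g b), sub_self]
    · simp only [LinearMap.comp_apply, LinearMap.zero_apply, LinearMap.inr_apply, hσ3', map_neg,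
        hσ4, hgf, zero_tmul, map_zero, neg_zero]
  · refine TensorProduct.ext' fun b c => ?_
    have hsplit : (wedge2 R (f (r b)) (s c) + κ • wedge2 R (s (g b)) (s c),
        -(r b ⊗ₜ[R] u (h c))) = (wedge2 R (f (r b)) (s c), (0 : A ⊗[R] C)) +
        κ • (wedge2 R (s (g b)) (s c), (0 : A ⊗[R] C)) - (0, r b ⊗ₜ[R] u (h c)) := by
      simp
    have hgsg : g (s (g b)) = g b := by simpa [hhg] using hC (g b)
    simp only [LinearMap.comp_apply, LinearMap.add_apply, LinearMap.id_apply, hp3, hσ4, hp4,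
      hsplit, map_add, map_sub, map_smul, hσ3, hσ3', hgf, hhg, hgsg, map_zero, tmul_zero,
      add_zero, tmul_add]
    have hb : b ⊗ₜ[R] c = f (r b) ⊗ₜ[R] g (s c) + f (r b) ⊗ₜ[R] u (h c) +
        s (g b) ⊗ₜ[R] c := by
      rw [← tmul_add, hC, ← add_tmul, hB]
    have hc : s (g b) ⊗ₜ[R] c = s (g b) ⊗ₜ[R] g (s c) + s (g b) ⊗ₜ[R] u (h c) := by
      rw [← tmul_add, hC]
    rw [hb, hc]
    linear_combination (norm := module) hκ • (s (g b) ⊗ₜ[R] g (s c) + s (g b) ⊗ₜ[R] u (h c))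
  · refine TensorProduct.ext' fun b c => ?_
    simp only [LinearMap.comp_apply, LinearMap.zero_apply, hσ4, hσ5, hhg, zero_tmul, map_zero]
  · refine sym2Mod_hom_ext fun c c' => ?_
    simp only [LinearMap.comp_apply, LinearMap.add_apply, LinearMap.id_apply, hp4, hσ5, hp5,
      map_smul, map_add, hσ4, tmul_add]
    have hexp : c ⊗ₜ[R] c' = g (s c) ⊗ₜ[R] g (s c') + g (s c) ⊗ₜ[R] u (h c') +
        (u (h c) ⊗ₜ[R] g (s c') + u (h c) ⊗ₜ[R] u (h c')) := by
      rw [← tmul_add, ← tmul_add, ← add_tmul, hC, hC]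
    have h1 : g (s c) ⊗ₜ[R] c' = g (s c) ⊗ₜ[R] g (s c') + g (s c) ⊗ₜ[R] u (h c') := by
      rw [← tmul_add, hC]
    have h2 : g (s c') ⊗ₜ[R] c = g (s c') ⊗ₜ[R] g (s c) + g (s c') ⊗ₜ[R] u (h c) := by
      rw [← tmul_add, hC]
    rw [h1, h2, hexp]
    simp only [map_add]
    rw [symRel_mkQ_comm R (g (s c')) (g (s c)), symRel_mkQ_comm R (g (s c')) (u (h c))]
    linear_combination (norm := module) hκ • ((symRel R C).mkQ (g (s c) ⊗ₜ[R] g (s c')) +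
      (symRel R C).mkQ (g (s c) ⊗ₜ[R] u (h c')) + (symRel R C).mkQ (u (h c) ⊗ₜ[R] g (s c')))
  · refine Function.RightInverse.surjective (g := p5)
      (LinearMap.congr_fun (?_ : σ5 ∘ₗ p5 = .id))
    refine sym2Mod_hom_ext fun e e' => ?_
    simp only [LinearMap.comp_apply, LinearMap.id_apply, hp5, hσ5, hhu]

end
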